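/- arXiv:1302.3060 — 2 statements merged into one kernel-verified Lean document; each statement's English description precedes it below -/
import Mathlib

section
/- Let ε be a nontrivial character of U_F with values in E^× of conductor ν ≥ 1, λ, μ ∈ E, k₀ ∈ ℤ, and for each l ≥ k₀ let c′_l, c″_l ∈ 𝒞. Let C′_l, C″_l ∈ 𝒞 be defined by C′_{k₀} = c′_{k₀}, C″_{k₀} = c″_{k₀}, and for l > k₀: C′_l = λSC′_{l−1} + c′_l and C″_l = μSC″_{l−1} + c″_l. Set C_l = E_ε C′_l + C″_l and C̃_l = E_{ε^{-1}} C″_l + C′_l. Fix l with k₀ < l, and assume C_{l−1} ∈ 𝒞₁ and C̃_{l−1} ∈ 𝒞₁. Then, in the sup norm ‖f‖ = max_{β} |f(β)|: ‖C′_l‖ ≤ max(|λq|·‖C̃_{l−1}‖, ‖c′_l‖) and ‖C″_l‖ ≤ max(|μq|·‖C_{l−1}‖, ‖c″_l‖). -/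
open scoped Classical

noncomputable section

namespace BS

variable (E : Type) [Field E]

/-- The ring of integers of a subfield `F` of `E`, with respect to a nonarchimedean
absolute value on `E`, as an additive subgroup of `F`. -/
def OFadd (abs : AbsoluteValue E ℝ)
    (na : ∀ x y : E, abs (x + y) ≤ max (abs x) (abs y))
    (F : Subfield E) : AddSubgroup F where
  carrier := {x | abs (x : E) ≤ 1}
  zero_mem' := by simp
  add_mem' := by
    intro a b ha hb
    simp only [Set.mem_setOf_eq] at *
    have h : ((a + b : F) : E) = (a : E) + (b : E) := by push_cast; ring
    rw [h]
    exact le_trans (na _ _) (max_le ha hb)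
  neg_mem' := by
    intro a ha
    simp only [Set.mem_setOf_eq] at *
    have h : ((-a : F) : E) = -(a : E) := by push_cast; ring
    rw [h, abs.map_neg]
    exact ha

/-- `W = F/O_F`. -/
abbrev Wq (abs : AbsoluteValue E ℝ)
    (na : ∀ x y : E, abs (x + y) ≤ max (abs x) (abs y))
    (F : Subfield E) : Type := F ⧸ OFadd E abs na F

/-- The canonical projection `F → W = F/O_F`. -/
def mkW (abs : AbsoluteValue E ℝ)
    (na : ∀ x y : E, abs (x + y) ≤ max (abs x) (abs y))
    (F : Subfield E) : F →+ Wq E abs na F := QuotientAddGroup.mk' _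

/-- Multiplication by `π` on `W = F/O_F`. -/
def pmulW (abs : AbsoluteValue E ℝ)
    (na : ∀ x y : E, abs (x + y) ≤ max (abs x) (abs y))
    (F : Subfield E) (π : F) (hπ : abs (π : E) ≤ 1) :
    Wq E abs na F →+ Wq E abs na F :=
  QuotientAddGroup.map _ _ (AddMonoidHom.mulLeft π) (by
    intro x hx
    simp only [AddSubgroup.mem_comap, AddMonoidHom.coe_mulLeft]
    show abs ((π * x : F) : E) ≤ 1
    have h : ((π * x : F) : E) = (π : E) * (x : E) := by push_cast; ring
    rw [h, abs.map_mul]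
    have hx' : abs (x : E) ≤ 1 := hx
    nlinarith [abs.nonneg (x : E), abs.nonneg (π : E)])


/-- The suspension operator `Sf(β) = Σ_{α : πα=β} f(α)` on functions on `W`. -/
def Sop (abs : AbsoluteValue E ℝ)
    (na : ∀ x y : E, abs (x + y) ≤ max (abs x) (abs y))
    (F : Subfield E) (π : F) (hπ : abs (π : E) ≤ 1)
    (f : Wq E abs na F → E) (β : Wq E abs na F) : E :=
  ∑ᶠ (α : Wq E abs na F) (_ : pmulW E abs na F π hπ α = β), f α

/-- `𝒞₀ = {f : Σ_{t∈W₁} f(β+t) = 0 for all β}`; here `W₁ = ker(π· : W → W)`. -/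
def predC0 (abs : AbsoluteValue E ℝ)
    (na : ∀ x y : E, abs (x + y) ≤ max (abs x) (abs y))
    (F : Subfield E) (π : F) (hπ : abs (π : E) ≤ 1)
    (f : Wq E abs na F → E) : Prop :=
  ∀ β : Wq E abs na F,
    (∑ᶠ (t : Wq E abs na F) (_ : pmulW E abs na F π hπ t = 0), f (β + t)) = 0

/-- `𝒞₁ = {f : f(β) depends only on πβ}`. -/
def predC1 (abs : AbsoluteValue E ℝ)
    (na : ∀ x y : E, abs (x + y) ≤ max (abs x) (abs y))
    (F : Subfield E) (π : F) (hπ : abs (π : E) ≤ 1)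
    (f : Wq E abs na F → E) : Prop :=
  ∀ β β' : Wq E abs na F, pmulW E abs na F π hπ β = pmulW E abs na F π hπ β' → f β = f β'

/-- The subset `{δ ∈ W : δ = π^{-ν}u·O_F for a unit u}` of `W`, i.e. the classes of the
elements of absolute value `|π|^{-ν}`; it is in natural bijection with `U_F/U_F^ν`. -/
def Dnu (abs : AbsoluteValue E ℝ)
    (na : ∀ x y : E, abs (x + y) ≤ max (abs x) (abs y))
    (F : Subfield E) (π : F) (ν : ℕ) : Set (Wq E abs na F) :=
  {δ | ∃ b : F, mkW E abs na F b = δ ∧ abs (b : E) = abs (π : E) ^ (-(ν : ℤ))}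

/-- The Gauss sum `τ(ξ⁻¹) = Σ_{u ∈ U_F/U_F^ν} ψ(π^{-ν}u)ξ(u)`, written as a sum over the
classes `δ = π^{-ν}u·O_F ∈ W` (the summand depends only on the class of `u` in `U_F/U_F^ν`,
i.e. only on `δ`, so any lift — here `Quotient.out δ` — may be used). -/
def gauss (abs : AbsoluteValue E ℝ)
    (na : ∀ x y : E, abs (x + y) ≤ max (abs x) (abs y))
    (F : Subfield E) (π : F) (ψ ξ : F → E) (ν : ℕ) : E :=
  ∑ᶠ (δ : Wq E abs na F) (_ : δ ∈ Dnu E abs na F π ν),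
    ψ (Quotient.out δ) * ξ (π ^ ν * Quotient.out δ)

/-- The convolution operator
`E_ξ f(β) = (τ(ξ⁻¹)/q^ν) Σ_{u ∈ U_F/U_F^ν} ξ⁻¹(u) f(β − π^{-ν}u)`, written as a sum over
the classes `δ = π^{-ν}u·O_F ∈ W` (with `u = π^ν·(any lift of δ)`). -/
def Eop (abs : AbsoluteValue E ℝ)
    (na : ∀ x y : E, abs (x + y) ≤ max (abs x) (abs y))
    (F : Subfield E) (π : F) (ψ ξ : F → E) (ν q : ℕ)
    (f : Wq E abs na F → E) (β : Wq E abs na F) : E :=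
  (gauss E abs na F π ψ ξ ν / (q : E) ^ ν) *
    ∑ᶠ (δ : Wq E abs na F) (_ : δ ∈ Dnu E abs na F π ν),
      (ξ (π ^ ν * Quotient.out δ))⁻¹ * f (β - δ)

section

variable (abs : AbsoluteValue E ℝ)
    (na : ∀ x y : E, abs (x + y) ≤ max (abs x) (abs y))
    (F : Subfield E) (π : F)

theorem mkW_eq_mkW_iff (a b : F) :
    mkW E abs na F a = mkW E abs na F b ↔ abs ((a : E) - b) ≤ 1 := by
  rw [← sub_eq_zero, ← map_sub]
  refine (QuotientAddGroup.eq_zero_iff (a - b)).trans ?_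
  show abs ((a - b : F) : E) ≤ 1 ↔ _
  rw [Subfield.coe_sub]

theorem mkW_surjective : Function.Surjective (mkW E abs na F) :=
  QuotientAddGroup.mk'_surjective _

theorem mkW_out (δ : Wq E abs na F) : mkW E abs na F (Quotient.out δ) = δ :=
  Quotient.out_eq' δ

theorem pmulW_mkW (x : F) (hx : abs (x : E) ≤ 1) (b : F) :
    pmulW E abs na F x hx (mkW E abs na F b) = mkW E abs na F (x * b) := rfl

theorem pmulW_inv_cancel (u v : F) (hu : abs (u : E) ≤ 1) (hv : abs (v : E) ≤ 1)
    (h : u * v = 1) (α : Wq E abs na F) :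
    pmulW E abs na F u hu (pmulW E abs na F v hv α) = α := by
  obtain ⟨b, rfl⟩ := mkW_surjective E abs na F α
  rw [pmulW_mkW, pmulW_mkW, ← mul_assoc, h, one_mul]

include na in
/-- Elements at distance at most `1` have the same absolute value when one of these
exceeds `1`. -/
theorem abs_eq_of_sub_le_one {a b : E} (h : abs (a - b) ≤ 1) (hb : 1 < abs b) :
    abs a = abs b := by
  apply le_antisymm
  · have := na (a - b) b
    rw [sub_add_cancel] at this
    exact this.trans (max_le (h.trans hb.le) le_rfl)
  · have := na (b - a) a
    rw [sub_add_cancel, abs.map_sub b a] at this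
    rcases le_max_iff.1 this with h' | h'
    · linarith
    · exact h'

theorem one_lt_zpow_neg (hπ0 : π ≠ 0) (hπ1 : abs (π : E) < 1) {ν : ℕ} (hν : 1 ≤ ν) :
    1 < abs (π : E) ^ (-(ν : ℤ)) := by
  have h0 : 0 < abs (π : E) := abs.pos (by simpa using hπ0)
  rw [zpow_neg, zpow_natCast]
  exact (one_lt_inv₀ (pow_pos h0 _)).2 (pow_lt_one₀ h0.le hπ1 (by omega))

theorem mkW_mem_Dnu_iff (hπ0 : π ≠ 0) (hπ1 : abs (π : E) < 1) {ν : ℕ} (hν : 1 ≤ ν) (b : F) :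
    mkW E abs na F b ∈ Dnu E abs na F π ν ↔ abs (b : E) = abs (π : E) ^ (-(ν : ℤ)) := by
  refine ⟨?_, fun h => ⟨b, rfl, h⟩⟩
  rintro ⟨b', hb', h⟩
  rw [mkW_eq_mkW_iff, abs.map_sub] at hb'
  rw [← h]
  apply abs_eq_of_sub_le_one E abs na hb'
  rw [h]
  exact one_lt_zpow_neg E abs F π hπ0 hπ1 hν

theorem abs_pow_mul_eq_one (hπ0 : π ≠ 0) {ν : ℕ} {b : F}
    (h : abs (b : E) = abs (π : E) ^ (-(ν : ℤ))) : abs ((π ^ ν * b : F) : E) = 1 := by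
  have h0 : 0 < abs (π : E) := abs.pos (by simpa using hπ0)
  rw [Subfield.coe_mul, SubmonoidClass.coe_pow, abs.map_mul, abs.map_pow, h, zpow_neg, zpow_natCast]
  exact mul_inv_cancel₀ (pow_pos h0 _).ne'

/-- The convolution kernel `δ = π^{-ν}u ↦ ξ⁻¹(u)` defining `Eop`, extended by zero to `W`. -/
def unitKernel (ξ : F → E) (ν : ℕ) (δ : Wq E abs na F) : E :=
  if δ ∈ Dnu E abs na F π ν then (ξ (π ^ ν * Quotient.out δ))⁻¹ else 0

theorem unitKernel_mkW (hπ0 : π ≠ 0) (hπ1 : abs (π : E) < 1) {ν : ℕ} (hν : 1 ≤ ν) (ξ : F → E)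
    (hmul : ∀ u v : F, abs (u : E) = 1 → abs (v : E) = 1 → ξ (u * v) = ξ u * ξ v)
    (hcond : ∀ u : F, abs (u : E) = 1 → abs ((u : E) - 1) ≤ abs (π : E) ^ ν → ξ u = 1)
    (b : F) :
    unitKernel E abs na F π ξ ν (mkW E abs na F b) =
      if abs (b : E) = abs (π : E) ^ (-(ν : ℤ)) then (ξ (π ^ ν * b))⁻¹ else 0 := by
  unfold unitKernel
  simp only [mkW_mem_Dnu_iff E abs na F π hπ0 hπ1 hν]
  split_ifs with h
  swap
  · rfl
  set b' : F := Quotient.out (mkW E abs na F b) with hb'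
  have hsub : abs ((b' : E) - b) ≤ 1 :=
    (mkW_eq_mkW_iff E abs na F _ _).1 (mkW_out E abs na F (mkW E abs na F b))
  have h' : abs (b' : E) = abs (π : E) ^ (-(ν : ℤ)) := by
    rw [← h]
    apply abs_eq_of_sub_le_one E abs na hsub
    rw [h]
    exact one_lt_zpow_neg E abs F π hπ0 hπ1 hν
  have h0 : 0 < abs (π : E) := abs.pos (by simpa using hπ0)
  have hbpos : 0 < abs (b : E) := by rw [h]; positivity
  have hb0 : (b : E) ≠ 0 := abs.pos_iff.1 hbpos
  have hb0' : b ≠ 0 := fun h => hb0 (by simp [h])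
  have hr : abs ((b' / b : F) : E) = 1 := by
    rw [Subfield.coe_div, map_div₀, h', h]
    exact div_self (by positivity)
  have hr1 : ξ (b' / b) = 1 := by
    apply hcond _ hr
    have : ((b' / b : F) : E) - 1 = ((b' : E) - b) / b := by
      rw [Subfield.coe_div]; field_simp
    rw [this, map_div₀, h, zpow_neg, zpow_natCast, div_inv_eq_mul]
    exact mul_le_of_le_one_left (by positivity) hsub
  have : π ^ ν * b' = (b' / b) * (π ^ ν * b) := by field_simp
  rw [this, hmul _ _ hr (abs_pow_mul_eq_one E abs F π hπ0 h), hr1, one_mul]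

/-- The kernel of `Eop` sums to zero over the fibres of multiplication by `π`. -/
theorem finsum_unitKernel_fiber (hπ0 : π ≠ 0) (hπ1 : abs (π : E) < 1) {ν : ℕ} (hν : 1 ≤ ν)
    (ξ : F → E)
    (hmul : ∀ u v : F, abs (u : E) = 1 → abs (v : E) = 1 → ξ (u * v) = ξ u * ξ v)
    (hcond : ∀ u : F, abs (u : E) = 1 → abs ((u : E) - 1) ≤ abs (π : E) ^ ν → ξ u = 1)
    (hnontriv : ∃ u : F, abs (u : E) = 1 ∧ abs ((u : E) - 1) ≤ abs (π : E) ^ (ν - 1) ∧ ξ u ≠ 1)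
    (γ : Wq E abs na F) :
    ∑ᶠ α, (if pmulW E abs na F π hπ1.le α = γ then unitKernel E abs na F π ξ ν α else 0) = 0 := by
  obtain ⟨u, hu, hu1, hξu⟩ := hnontriv
  have hu0 : u ≠ 0 := by rintro rfl; simp at hu
  have hv : abs ((u⁻¹ : F) : E) = 1 := by rw [Subfield.coe_inv, map_inv₀, hu, inv_one]
  let m : Wq E abs na F ≃ Wq E abs na F :=
    { toFun := pmulW E abs na F u hu.le
      invFun := pmulW E abs na F u⁻¹ hv.le
      left_inv := pmulW_inv_cancel E abs na F _ _ _ _ (inv_mul_cancel₀ hu0)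
      right_inv := pmulW_inv_cancel E abs na F _ _ _ _ (mul_inv_cancel₀ hu0) }
  have h0 : 0 < abs (π : E) := abs.pos (by simpa using hπ0)
  set G : Wq E abs na F → E := fun α =>
    if pmulW E abs na F π hπ1.le α = γ then unitKernel E abs na F π ξ ν α else 0 with hG
  have key : ∀ α, G (m α) = (ξ u)⁻¹ * G α := by
    intro α
    obtain ⟨b, rfl⟩ := mkW_surjective E abs na F α
    have hm : m (mkW E abs na F b) = mkW E abs na F (u * b) := rfl
    have hab : abs ((u * b : F) : E) = abs (b : E) := by
      rw [Subfield.coe_mul, abs.map_mul, hu, one_mul]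
    simp only [hG, hm, unitKernel_mkW E abs na F π hπ0 hπ1 hν ξ hmul hcond, hab]
    by_cases hb : abs (b : E) = abs (π : E) ^ (-(ν : ℤ))
    swap
    · simp only [if_neg hb, ite_self, mul_zero]
    have hfib : pmulW E abs na F π hπ1.le (mkW E abs na F (u * b)) =
        pmulW E abs na F π hπ1.le (mkW E abs na F b) := by
      rw [pmulW_mkW, pmulW_mkW, mkW_eq_mkW_iff]
      have : ((π * (u * b) : F) : E) - (π * b : F) = π * ((u : E) - 1) * b := by
        push_cast; ring
      rw [this, abs.map_mul, abs.map_mul, hb, zpow_neg, zpow_natCast, ← div_eq_mul_inv,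
        div_le_one (by positivity)]
      calc abs (π : E) * abs ((u : E) - 1) ≤ abs (π : E) * abs (π : E) ^ (ν - 1) := by gcongr
        _ = abs (π : E) ^ ν := by rw [← pow_succ', Nat.sub_add_cancel hν]
    have hξ : ξ (π ^ ν * (u * b)) = ξ u * ξ (π ^ ν * b) := by
      rw [← hmul _ _ hu (abs_pow_mul_eq_one E abs F π hπ0 hb)]
      congr 1; ring
    rw [hfib, if_pos hb, if_pos hb, hξ, mul_inv, mul_ite, mul_zero]
  have hsum : ∑ᶠ α, G α = (ξ u)⁻¹ * ∑ᶠ α, G α := by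
    conv_lhs => rw [← finsum_comp_equiv m]
    simp only [key, ← smul_eq_mul]
    exact (smul_finsum _ _).symm
  have : (1 - (ξ u)⁻¹) * ∑ᶠ α, G α = 0 := by linear_combination hsum
  refine (mul_eq_zero.1 this).resolve_left fun h => hξu ?_
  rw [sub_eq_zero] at h
  rw [← inv_inv (ξ u), ← h, inv_one]

theorem Eop_eq_unitKernel (ψ ξ : F → E) (ν q : ℕ) (f : Wq E abs na F → E)
    (hf : f.support.Finite) (α : Wq E abs na F) :
    Eop E abs na F π ψ ξ ν q f α = gauss E abs na F π ψ ξ ν / (q : E) ^ ν *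
      ∑ η ∈ hf.toFinset, unitKernel E abs na F π ξ ν (α - η) * f η := by
  unfold Eop
  congr 1
  have h : ∀ δ : Wq E abs na F, (∑ᶠ (_ : δ ∈ Dnu E abs na F π ν),
      (ξ (π ^ ν * Quotient.out δ))⁻¹ * f (α - δ)) =
      unitKernel E abs na F π ξ ν δ * f (α - δ) := by
    intro δ
    rw [finsum_eq_if, unitKernel, ite_mul, zero_mul]
  rw [finsum_congr h, ← finsum_comp_equiv (Equiv.subLeft α)]
  simp only [Equiv.subLeft_apply, sub_sub_cancel]
  apply finsum_eq_sum_of_support_subset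
  intro η hη
  simpa using right_ne_zero_of_mul hη

/-- `S ∘ E_ξ = 0`. -/
theorem Sop_Eop (hπ0 : π ≠ 0) (hπ1 : abs (π : E) < 1) {ν : ℕ} (hν : 1 ≤ ν)
    (ψ ξ : F → E)
    (hmul : ∀ u v : F, abs (u : E) = 1 → abs (v : E) = 1 → ξ (u * v) = ξ u * ξ v)
    (hcond : ∀ u : F, abs (u : E) = 1 → abs ((u : E) - 1) ≤ abs (π : E) ^ ν → ξ u = 1)
    (hnontriv : ∃ u : F, abs (u : E) = 1 ∧ abs ((u : E) - 1) ≤ abs (π : E) ^ (ν - 1) ∧ ξ u ≠ 1)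
    (q : ℕ) (hfib : ∀ γ : Wq E abs na F, {β | pmulW E abs na F π hπ1.le β = γ}.Finite)
    (f : Wq E abs na F → E) (hf : f.support.Finite) (β : Wq E abs na F) :
    Sop E abs na F π hπ1.le (Eop E abs na F π ψ ξ ν q f) β = 0 := by
  show ∑ᶠ α ∈ {α | pmulW E abs na F π hπ1.le α = β}, Eop E abs na F π ψ ξ ν q f α = 0
  rw [finsum_mem_eq_finite_toFinset_sum _ (hfib β)]
  simp only [Eop_eq_unitKernel E abs na F π ψ ξ ν q f hf]
  rw [← Finset.mul_sum, Finset.sum_comm]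
  refine mul_eq_zero_of_right _ (Finset.sum_eq_zero fun η _ => ?_)
  rw [← Finset.sum_mul]
  refine mul_eq_zero_of_left ?_ _
  rw [← finsum_mem_eq_finite_toFinset_sum (fun α => unitKernel E abs na F π ξ ν (α - η)) (hfib β),
    ← finsum_unitKernel_fiber E abs na F π hπ0 hπ1 hν ξ hmul hcond hnontriv
      (β - pmulW E abs na F π hπ1.le η)]
  refine Eq.trans ?_ (finsum_comp_equiv (Equiv.subRight η))
  refine finsum_congr fun α => ?_
  simp only [Equiv.subRight_apply, map_sub, sub_left_inj, finsum_eq_if, Set.mem_ofPred_eq]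

theorem finite_Dnu (hπ0 : π ≠ 0) (hπ : abs (π : E) ≤ 1)
    (hfib : ∀ γ : Wq E abs na F, {β | pmulW E abs na F π hπ β = γ}.Finite) (ν : ℕ) :
    (Dnu E abs na F π ν).Finite := by
  have hpow : ∀ n : ℕ, {α : Wq E abs na F | (pmulW E abs na F π hπ)^[n] α = 0}.Finite := by
    intro n
    induction n with
    | zero => simp
    | succ n ih => exact ih.preimage' fun b _ => hfib b
  refine (hpow ν).subset ?_
  rintro _ ⟨b, rfl, hb⟩
  have hiter : ∀ n : ℕ, (pmulW E abs na F π hπ)^[n] (mkW E abs na F b) =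
      mkW E abs na F (π ^ n * b) := by
    intro n
    induction n with
    | zero => simp
    | succ n ih => rw [Function.iterate_succ_apply', ih, pmulW_mkW, ← mul_assoc, pow_succ']
  show (pmulW E abs na F π hπ)^[ν] (mkW E abs na F b) = 0
  rw [hiter, ← map_zero (mkW E abs na F), mkW_eq_mkW_iff, Subfield.coe_zero, sub_zero]
  exact (abs_pow_mul_eq_one E abs F π hπ0 hb).le

theorem finite_support_Sop (hπ : abs (π : E) ≤ 1) (f : Wq E abs na F → E)
    (hf : f.support.Finite) : (Sop E abs na F π hπ f).support.Finite := by
  refine (hf.image (pmulW E abs na F π hπ)).subset fun β hβ => ?_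
  obtain ⟨α, hα, h⟩ := exists_ne_zero_of_finsum_mem_ne_zero
    (s := {α | pmulW E abs na F π hπ α = β}) hβ
  exact ⟨α, h, hα⟩

theorem finite_support_Eop (ψ ξ : F → E) (ν q : ℕ) (hD : (Dnu E abs na F π ν).Finite)
    (f : Wq E abs na F → E) (hf : f.support.Finite) :
    (Eop E abs na F π ψ ξ ν q f).support.Finite := by
  refine (hf.image2 (· + ·) hD).subset fun β hβ => ?_
  obtain ⟨δ, hδ, h⟩ := exists_ne_zero_of_finsum_mem_ne_zero (right_ne_zero_of_mul hβ)
  exact ⟨β - δ, right_ne_zero_of_mul h, δ, hδ, sub_add_cancel _ _⟩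

/-- Functions given by the recursion `C_l = λ S C_{l-1} + c_l` are finitely supported. -/
theorem finite_support_of_rec (hπ : abs (π : E) ≤ 1) (lam : E) (k0 : ℤ)
    (c C : ℤ → Wq E abs na F → E) (hc : ∀ k, (c k).support.Finite) (hbase : C k0 = c k0)
    (hrec : ∀ l : ℤ, k0 < l → C l = fun β => lam * Sop E abs na F π hπ (C (l - 1)) β + c l β)
    (l : ℤ) (hl : k0 ≤ l) : (C l).support.Finite := by
  induction l, hl using Int.leInduction with
  | base => rw [hbase]; exact hc k0
  | succ l hl ih =>
    rw [hrec (l + 1) (by omega), add_sub_cancel_right]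
    refine ((finite_support_Sop E abs na F π hπ _ ih).union (hc (l + 1))).subset fun β hβ => ?_
    by_contra h
    simp only [Set.mem_union, Function.mem_support, not_or, not_not] at h
    exact hβ (by simp [h.1, h.2])

theorem bddAbove_range_abs {X : Type*} (f : X → E) (hf : f.support.Finite) :
    BddAbove (Set.range fun x => abs (f x)) := by
  refine (((hf.image fun x => abs (f x)).insert 0).subset ?_).bddAbove
  rintro _ ⟨x, rfl⟩
  by_cases h : f x = 0
  · simp [h]
  · exact Or.inr ⟨x, h, rfl⟩

/-- One step of the recursion: if `g = E_ξ d + f` lies in `𝒞₁`, then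
`‖λ S f + c‖ ≤ max (|λ q| ‖g‖) ‖c‖`. -/
theorem iSup_abs_step_le (hπ0 : π ≠ 0) (hπ1 : abs (π : E) < 1) {ν : ℕ} (hν : 1 ≤ ν)
    (ψ ξ : F → E)
    (hmul : ∀ u v : F, abs (u : E) = 1 → abs (v : E) = 1 → ξ (u * v) = ξ u * ξ v)
    (hcond : ∀ u : F, abs (u : E) = 1 → abs ((u : E) - 1) ≤ abs (π : E) ^ ν → ξ u = 1)
    (hnontriv : ∃ u : F, abs (u : E) = 1 ∧ abs ((u : E) - 1) ≤ abs (π : E) ^ (ν - 1) ∧ ξ u ≠ 1)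
    (q : ℕ) (hq : 0 < q)
    (hcard : ∀ γ : Wq E abs na F,
      Nat.card {β : Wq E abs na F // pmulW E abs na F π hπ1.le β = γ} = q)
    (lam : E) (d f c : Wq E abs na F → E) (hd : d.support.Finite) (hf : f.support.Finite)
    (hc : c.support.Finite)
    (hC1 : predC1 E abs na F π hπ1.le (fun β => Eop E abs na F π ψ ξ ν q d β + f β)) :
    (⨆ β, abs (lam * Sop E abs na F π hπ1.le f β + c β)) ≤
      max (abs (lam * (q : E)) * ⨆ β, abs (Eop E abs na F π ψ ξ ν q d β + f β))
        (⨆ β, abs (c β)) := by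
  have hfib : ∀ γ : Wq E abs na F, {β | pmulW E abs na F π hπ1.le β = γ}.Finite := fun γ =>
    Nat.finite_of_card_ne_zero ((hcard γ).trans_ne hq.ne')
  have hD := finite_Dnu E abs na F π hπ0 hπ1.le hfib ν
  set g : Wq E abs na F → E := fun β => Eop E abs na F π ψ ξ ν q d β + f β with hg
  have hgfin : g.support.Finite :=
    ((finite_support_Eop E abs na F π ψ ξ ν q hD d hd).union hf).subset
      (Function.support_add _ _)
  refine ciSup_le fun β => (na _ _).trans (max_le_max ?_ ?_)
  swap
  · exact le_ciSup (bddAbove_range_abs E abs c hc) β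
  have hne : Nonempty {α : Wq E abs na F // pmulW E abs na F π hπ1.le α = β} :=
    (Nat.card_pos_iff.1 (by rw [hcard β]; exact hq)).1
  obtain ⟨α, hα⟩ := hne
  have hS : Sop E abs na F π hπ1.le f β = q * g α := by
    calc Sop E abs na F π hπ1.le f β
        = Sop E abs na F π hπ1.le (Eop E abs na F π ψ ξ ν q d) β +
            Sop E abs na F π hπ1.le f β := by
          rw [Sop_Eop E abs na F π hπ0 hπ1 hν ψ ξ hmul hcond hnontriv q hfib d hd, zero_add]
      _ = ∑ᶠ γ ∈ {γ | pmulW E abs na F π hπ1.le γ = β}, g γ :=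
          (finsum_mem_add_distrib (hfib β)).symm
      _ = ∑ γ ∈ (hfib β).toFinset, g α := by
          rw [finsum_mem_eq_finite_toFinset_sum _ (hfib β)]
          refine Finset.sum_congr rfl fun γ hγ => hC1 _ _ ?_
          rw [hα]
          simpa using hγ
      _ = q * g α := by
          rw [Finset.sum_const, nsmul_eq_mul, ← Set.ncard_eq_toFinset_card _ (hfib β)]
          congr 2
          exact hcard β
  rw [hS, ← mul_assoc, abs.map_mul]
  exact mul_le_mul_of_nonneg_left (le_ciSup (bddAbove_range_abs E abs g hgfin) α) (abs.nonneg _)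

end

/-- the key estimate (Lemma 4.2 of the paper): if `C_{l−1} ∈ 𝒞₁` and
`C̃_{l−1} ∈ 𝒞₁`, then in the sup norm,
`‖C′_l‖ ≤ max(|λq|·‖C̃_{l−1}‖, ‖c′_l‖)` and `‖C″_l‖ ≤ max(|μq|·‖C_{l−1}‖, ‖c″_l‖)`. -/
theorem stmt17 [CharZero E]
    (abs : AbsoluteValue E ℝ)
    (na : ∀ x y : E, abs (x + y) ≤ max (abs x) (abs y))
    (F : Subfield E) (π : F)
    (hπ0 : π ≠ 0) (hπ1 : abs (π : E) < 1)
    (hdisc : ∀ x : F, x ≠ 0 → ∃ k : ℤ, abs (x : E) = abs (π : E) ^ k)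
    -- the residue field has `q` elements
    (q : ℕ) (hq : 0 < q)
    (hcard : ∀ γ : Wq E abs na F,
      Nat.card {β : Wq E abs na F // pmulW E abs na F π hπ1.le β = γ} = q)
    -- `ψ` is an additive character of `F`, trivial on `O_F`, under which `O_F` is its own
    -- annihilator:
    (ψ : F → E)
    (hψadd : ∀ x y : F, ψ (x + y) = ψ x * ψ y)
    (hψO : ∀ x : F, abs (x : E) ≤ 1 → ψ x = 1)
    (hψann : ∀ b : F, 1 < abs (b : E) → ∃ x : F, abs (x : E) ≤ 1 ∧ ψ (b * x) ≠ 1)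
    -- `ε` is a character of `U_F` with values in `E^×`, of conductor `ν ≥ 1`:
    (ε : F → E) (ν : ℕ) (hν : 1 ≤ ν)
    (hεmul : ∀ u v : F, abs (u : E) = 1 → abs (v : E) = 1 → ε (u * v) = ε u * ε v)
    (hεne : ∀ u : F, abs (u : E) = 1 → ε u ≠ 0)
    (hεcond : ∀ u : F, abs (u : E) = 1 → abs ((u : E) - 1) ≤ abs (π : E) ^ ν → ε u = 1)
    (hεnontriv : ∃ u : F, abs (u : E) = 1 ∧ abs ((u : E) - 1) ≤ abs (π : E) ^ (ν - 1) ∧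
      ε u ≠ 1)
    (lam mu : E) (k0 : ℤ)
    (c' c'' : ℤ → Wq E abs na F → E)
    (hcfin : ∀ k : ℤ, {β | c' k β ≠ 0}.Finite ∧ {β | c'' k β ≠ 0}.Finite)
    (C' C'' : ℤ → Wq E abs na F → E)
    -- the recursive definition of `C′` and `C″`:
    (hC'base : C' k0 = c' k0) (hC''base : C'' k0 = c'' k0)
    (hC'rec : ∀ l : ℤ, k0 < l →
      C' l = fun β => lam * Sop E abs na F π hπ1.le (C' (l-1)) β + c' l β)
    (hC''rec : ∀ l : ℤ, k0 < l →
      C'' l = fun β => mu * Sop E abs na F π hπ1.le (C'' (l-1)) β + c'' l β)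
    (l : ℤ) (hl : k0 < l)
    -- `C_{l−1} = E_ε C′_{l−1} + C″_{l−1} ∈ 𝒞₁`:
    (hC1 : predC1 E abs na F π hπ1.le
      (fun β => Eop E abs na F π ψ ε ν q (C' (l-1)) β + C'' (l-1) β))
    -- `C̃_{l−1} = E_{ε⁻¹} C″_{l−1} + C′_{l−1} ∈ 𝒞₁`:
    (hC1t : predC1 E abs na F π hπ1.le
      (fun β => Eop E abs na F π ψ (fun x => (ε x)⁻¹) ν q (C'' (l-1)) β + C' (l-1) β)) :
    (⨆ β : Wq E abs na F, abs (C' l β)) ≤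
      max (abs (lam * (q : E)) * ⨆ β : Wq E abs na F,
            abs (Eop E abs na F π ψ (fun x => (ε x)⁻¹) ν q (C'' (l-1)) β + C' (l-1) β))
          (⨆ β : Wq E abs na F, abs (c' l β)) ∧
    (⨆ β : Wq E abs na F, abs (C'' l β)) ≤
      max (abs (mu * (q : E)) * ⨆ β : Wq E abs na F,
            abs (Eop E abs na F π ψ ε ν q (C' (l-1)) β + C'' (l-1) β))
          (⨆ β : Wq E abs na F, abs (c'' l β)) := by
  have hne : ∀ u : F, abs (u : E) = 1 ∧ abs ((u : E) - 1) ≤ abs (π : E) ^ (ν - 1) ∧ ε u ≠ 1 →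
      abs (u : E) = 1 ∧ abs ((u : E) - 1) ≤ abs (π : E) ^ (ν - 1) ∧ (ε u)⁻¹ ≠ 1 :=
    fun u ⟨h1, h2, h3⟩ => ⟨h1, h2, inv_ne_one.2 h3⟩
  have hfin' := finite_support_of_rec E abs na F π hπ1.le lam k0 c' C' (fun k => (hcfin k).1)
    hC'base hC'rec (l - 1) (by omega)
  have hfin'' := finite_support_of_rec E abs na F π hπ1.le mu k0 c'' C'' (fun k => (hcfin k).2)
    hC''base hC''rec (l - 1) (by omega)
  rw [hC'rec l hl, hC''rec l hl]
  constructor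
  · exact iSup_abs_step_le E abs na F π hπ0 hπ1 hν ψ _
      (fun u v hu hv => by rw [hεmul u v hu hv, mul_inv])
      (fun u hu h => by rw [hεcond u hu h, inv_one])
      (hεnontriv.imp hne) q hq hcard lam _ _ _ hfin'' hfin' (hcfin l).1 hC1t
  · exact iSup_abs_step_le E abs na F π hπ0 hπ1 hν ψ _ hεmul hεcond hεnontriv q hq hcard
      mu _ _ _ hfin' hfin'' (hcfin l).2 hC1

end BS
end
end

section
/- Let V be an E-vector space, λ ∈ E, k₀ ∈ ℤ, and for each k ≥ k₀ let c′_k, c″_k : W → V be finitely supported, zero for all but finitely many k. Define C′_l(β) = Σ_{k=k₀}^{l} λ^{l−k} Σ_{α∈W : π^{l−k}α=β} c′_k(α), C″_l(β) = Σ_{k=k₀}^{l} (k−l) λ^{l−k} Σ_{α∈W : π^{l−k}α=β} c″_k(α), and C_l = C′_l + C″_l. Then for every l > k₀ and γ ∈ W: C_{l+1}(γ) = 2λ Σ_{β : πβ=γ} C_l(β) − λ² Σ_{β : πβ=γ} Σ_{α : πα=β} C_{l−1}(α) − λ Σ_{β : πβ=γ} (c″_l(β) + c′_l(β)) + c′_{l+1}(γ).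 -/
open scoped Classical

noncomputable section

namespace BS

variable (E : Type) [Field E]

/-- The coefficient `C′_l(β) = Σ_{k=k₀}^{l} λ^{l−k} Σ_{α∈W : π^{l−k}α=β} c_k(α)`. -/
def Csum {V : Type} [AddCommGroup V] [Module E V]
    (abs : AbsoluteValue E ℝ)
    (na : ∀ x y : E, abs (x + y) ≤ max (abs x) (abs y))
    (F : Subfield E) (π : F) (hπ : abs (π : E) ≤ 1)
    (lam : E) (k0 : ℤ) (c : ℤ → Wq E abs na F → V) (l : ℤ) (β : Wq E abs na F) : V :=
  ∑ k ∈ Finset.Icc k0 l, lam ^ (l - k).toNat •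
    (∑ᶠ (α : Wq E abs na F) (_ : (⇑(pmulW E abs na F π hπ))^[(l - k).toNat] α = β), c k α)

/-- The coefficient `C″_l(β) = Σ_{k=k₀}^{l} (k−l) λ^{l−k} Σ_{α∈W : π^{l−k}α=β} c_k(α)`. -/
def CsumD {V : Type} [AddCommGroup V] [Module E V]
    (abs : AbsoluteValue E ℝ)
    (na : ∀ x y : E, abs (x + y) ≤ max (abs x) (abs y))
    (F : Subfield E) (π : F) (hπ : abs (π : E) ≤ 1)
    (lam : E) (k0 : ℤ) (c : ℤ → Wq E abs na F → V) (l : ℤ) (β : Wq E abs na F) : V :=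
  ∑ k ∈ Finset.Icc k0 l, (k - l) • (lam ^ (l - k).toNat •
    (∑ᶠ (α : Wq E abs na F) (_ : (⇑(pmulW E abs na F π hπ))^[(l - k).toNat] α = β), c k α))

section FiberSum

variable {E} {V W : Type*} [AddCommGroup V] [Module E V]

/-- Summation over the fibres of a map with finite fibres, as an endomorphism of `W → V`. -/
def fiberSum (p : W → W) (hp : ∀ γ, {β | p β = γ}.Finite) : Module.End E (W → V) where
  toFun f γ := ∑ᶠ (β : W) (_ : p β = γ), f β
  map_add' f g := by
    ext γ
    exact finsum_mem_add_distrib (hp γ)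
  map_smul' a f := by
    ext γ
    exact (smul_finsum_mem (r := a) (f := f) (hp γ)).symm

lemma fiberSum_apply (p : W → W) (hp : ∀ γ, {β | p β = γ}.Finite) (f : W → V) (γ : W) :
    (fiberSum p hp : Module.End E (W → V)) f γ = ∑ᶠ (β : W) (_ : p β = γ), f β := rfl

lemma finite_fiber_iterate (p : W → W) (hp : ∀ γ, {β | p β = γ}.Finite) (n : ℕ) (γ : W) :
    {β | p^[n] β = γ}.Finite := by
  induction n generalizing γ with
  | zero => simp
  | succ n ih =>
    have h : {β | p^[n + 1] β = γ} = ⋃ δ ∈ {δ | p δ = γ}, {β | p^[n] β = δ} := by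
      ext β
      simp [Function.iterate_succ_apply']
    rw [h]
    exact (hp γ).biUnion fun δ _ => ih δ

lemma fiberSum_pow_apply (p : W → W) (hp : ∀ γ, {β | p β = γ}.Finite) (f : W → V) (n : ℕ)
    (γ : W) :
    ((fiberSum p hp : Module.End E (W → V)) ^ n) f γ =
      ∑ᶠ (β : W) (_ : p^[n] β = γ), f β := by
  induction n generalizing γ with
  | zero => simp
  | succ n ih =>
    have h : {β | p^[n + 1] β = γ} = ⋃ δ ∈ {δ | p δ = γ}, {β | p^[n] β = δ} := by
      ext β
      simp [Function.iterate_succ_apply']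
    have hd : ({δ | p δ = γ}).PairwiseDisjoint fun δ => {β | p^[n] β = δ} := by
      intro δ _ ε _ hne
      refine Set.disjoint_left.2 fun β hβ hβ' => hne ?_
      exact hβ.symm.trans hβ'
    have key := finsum_mem_biUnion (f := f) hd (hp γ)
      fun δ _ => finite_fiber_iterate p hp n δ
    rw [← h] at key
    rw [pow_succ', Module.End.mul_apply, fiberSum_apply]
    simp only [ih]
    exact key.symm

/-- The weighted partial sums `∑ k ∈ [k₀, l], T ^ (l - k) (c k)` satisfy a first-order
recursion. -/
lemma sum_Icc_pow_succ {M : Type*} [AddCommGroup M] [Module E M] (T : Module.End E M)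
    (c : ℤ → M) {k0 l : ℤ} (h : k0 ≤ l + 1) :
    ∑ k ∈ Finset.Icc k0 (l + 1), (T ^ (l + 1 - k).toNat) (c k) =
      T (∑ k ∈ Finset.Icc k0 l, (T ^ (l - k).toNat) (c k)) + c (l + 1) := by
  rw [← Finset.insert_Icc_right_eq_Icc_add_one h, Finset.sum_insert (by simp), map_sum,
    add_comm]
  congr 1
  · refine Finset.sum_congr rfl fun k hk => ?_
    have hk := (Finset.mem_Icc.1 hk).2
    rw [show (l + 1 - k).toNat = (l - k).toNat + 1 by omega, pow_succ', Module.End.mul_apply]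
  · simp

/-- The recursion for the partial sums weighted by `(k - l) T ^ (l - k)`. -/
lemma sum_Icc_sub_smul_pow_succ {M : Type*} [AddCommGroup M] [Module E M]
    (T : Module.End E M) (c : ℤ → M) {k0 l : ℤ} (h : k0 ≤ l + 1) :
    ∑ k ∈ Finset.Icc k0 (l + 1), (k - (l + 1)) • (T ^ (l + 1 - k).toNat) (c k) =
      T (∑ k ∈ Finset.Icc k0 l, (k - l) • (T ^ (l - k).toNat) (c k)) -
        T (∑ k ∈ Finset.Icc k0 l, (T ^ (l - k).toNat) (c k)) := by
  rw [← Finset.insert_Icc_right_eq_Icc_add_one h, Finset.sum_insert (by simp), ← map_sub,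
    ← Finset.sum_sub_distrib, map_sum]
  simp only [sub_self, zero_smul, zero_add]
  refine Finset.sum_congr rfl fun k hk => ?_
  have hk := (Finset.mem_Icc.1 hk).2
  rw [show (l + 1 - k).toNat = (l - k).toNat + 1 by omega, pow_succ', Module.End.mul_apply,
    map_sub, map_zsmul, ← sub_sub, sub_smul _ (1 : ℤ), one_smul]

/-- The second-order recursion obtained by eliminating the auxiliary sum. -/
lemma sum_Icc_pow_add_sub_smul_pow_succ {M : Type*} [AddCommGroup M] [Module E M]
    (T : Module.End E M) (c d : ℤ → M) (C : ℤ → M) {k0 l : ℤ} (h : k0 ≤ l)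
    (hC : ∀ m, C m = ∑ k ∈ Finset.Icc k0 m, (T ^ (m - k).toNat) (c k) +
      ∑ k ∈ Finset.Icc k0 m, (k - m) • (T ^ (m - k).toNat) (d k)) :
    C (l + 1) = (2 : E) • T (C l) - T (T (C (l - 1))) - T (d l + c l) + c (l + 1) := by
  have h0 : k0 ≤ l - 1 + 1 := by omega
  have h1 : k0 ≤ l + 1 := by omega
  have e1 := sum_Icc_pow_succ T c h0
  have e2 := sum_Icc_pow_succ T d h0
  have e3 := sum_Icc_sub_smul_pow_succ T d h0
  rw [sub_add_cancel] at e1 e2 e3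
  rw [hC, hC l, hC (l - 1), sum_Icc_pow_succ T c h1, sum_Icc_sub_smul_pow_succ T d h1, e1, e2, e3]
  simp only [map_add, map_sub, two_smul]
  abel

end FiberSum

/-- the recursion relation satisfied by `C_l = C′_l + C″_l` in the exceptional
case `χ₁ = ωχ₂` (Lemma 5.2 of the paper). -/
theorem stmt19 {V : Type} [AddCommGroup V] [Module E V]
    (abs : AbsoluteValue E ℝ)
    (na : ∀ x y : E, abs (x + y) ≤ max (abs x) (abs y))
    (F : Subfield E) (π : F)
    (hπ0 : π ≠ 0) (hπ1 : abs (π : E) < 1)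
    -- the residue field has `q` elements: every fibre of `π· : W → W` has `q` elements
    (q : ℕ) (hq : 0 < q)
    (hcard : ∀ γ : Wq E abs na F,
      Nat.card {β : Wq E abs na F // pmulW E abs na F π hπ1.le β = γ} = q)
    (lam : E) (k0 : ℤ)
    (c' c'' : ℤ → Wq E abs na F → V)
    (hfin : ∀ k : ℤ, {β | c' k β ≠ 0}.Finite ∧ {β | c'' k β ≠ 0}.Finite)
    (hfink : {k : ℤ | c' k ≠ 0 ∨ c'' k ≠ 0}.Finite) :
    ∀ l : ℤ, k0 < l → ∀ γ : Wq E abs na F,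
      (Csum E abs na F π hπ1.le lam k0 c' (l+1) γ +
        CsumD E abs na F π hπ1.le lam k0 c'' (l+1) γ) =
        (2 * lam) • (∑ᶠ (β : Wq E abs na F) (_ : pmulW E abs na F π hπ1.le β = γ),
            (Csum E abs na F π hπ1.le lam k0 c' l β +
              CsumD E abs na F π hπ1.le lam k0 c'' l β))
        - (lam ^ 2) • (∑ᶠ (β : Wq E abs na F) (_ : pmulW E abs na F π hπ1.le β = γ),
            ∑ᶠ (α : Wq E abs na F) (_ : pmulW E abs na F π hπ1.le α = β),
              (Csum E abs na F π hπ1.le lam k0 c' (l-1) α +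
                CsumD E abs na F π hπ1.le lam k0 c'' (l-1) α))
        - lam • (∑ᶠ (β : Wq E abs na F) (_ : pmulW E abs na F π hπ1.le β = γ),
            (c'' l β + c' l β))
        + c' (l+1) γ := by
  intro l hl γ
  have hp : ∀ γ, {β | pmulW E abs na F π hπ1.le β = γ}.Finite := fun γ =>
    Nat.finite_of_card_ne_zero (by rw [Set.coe_ofPred, hcard γ]; exact hq.ne')
  set S : Module.End E (Wq E abs na F → V) := fiberSum _ hp with hS
  have hC' : ∀ (c : ℤ → Wq E abs na F → V) m, Csum E abs na F π hπ1.le lam k0 c m =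
      ∑ k ∈ Finset.Icc k0 m, ((lam • S) ^ (m - k).toNat) (c k) := by
    intro c m
    ext β
    simp only [Csum, Finset.sum_apply, smul_pow, LinearMap.smul_apply, Pi.smul_apply, hS,
      fiberSum_pow_apply]
  have hC'' : ∀ (c : ℤ → Wq E abs na F → V) m, CsumD E abs na F π hπ1.le lam k0 c m =
      ∑ k ∈ Finset.Icc k0 m, (k - m) • ((lam • S) ^ (m - k).toNat) (c k) := by
    intro c m
    ext β
    simp only [CsumD, Finset.sum_apply, smul_pow, LinearMap.smul_apply, Pi.smul_apply, hS,
      fiberSum_pow_apply]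
  have key := congrFun (sum_Icc_pow_add_sub_smul_pow_succ (lam • S) c' c''
    (fun m => Csum E abs na F π hπ1.le lam k0 c' m + CsumD E abs na F π hπ1.le lam k0 c'' m)
    hl.le fun m => by rw [hC', hC'']) γ
  simp only [LinearMap.smul_apply, map_smul, smul_smul, ← sq] at key
  exact key

end BS
end
end
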